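/- There exists a constant C > 0 such that the function V(v) := |F⁽⁴⁾(‖v‖²/2)| ‖v‖⁴ + |F⁽³⁾(‖v‖²/2)| ‖v‖² + |F″(‖v‖²/2)| on ℂ^m \ {0} satisfies V(v) ≤ C ‖v‖^{−2} for all 0 < ‖v‖ ≤ 1, and V(v) ≤ C ‖v‖⁴ e^{−‖v‖²} for all ‖v‖ > 1. -/

import Mathlib

open MeasureTheory

/-- `F(λ) = -(1/(2π²)) ∫_λ^∞ log(1 - e^{-2s}) ds`. -/
noncomputable def F (lam : ℝ) : ℝ :=
  -(1 / (2 * Real.pi ^ 2)) * ∫ s in Set.Ioi lam, Real.log (1 - Real.exp (-2 * s))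

/-- The coefficient bound `V(v) = |F⁽⁴⁾(‖v‖²/2)| ‖v‖⁴ + |F⁽³⁾(‖v‖²/2)| ‖v‖² + |F″(‖v‖²/2)|`
for the universal limit variance current. -/
noncomputable def V (m : ℕ) (v : EuclideanSpace ℂ (Fin m)) : ℝ :=
  |iteratedDeriv 4 F (‖v‖ ^ 2 / 2)| * ‖v‖ ^ 4 +
    |iteratedDeriv 3 F (‖v‖ ^ 2 / 2)| * ‖v‖ ^ 2 +
    |iteratedDeriv 2 F (‖v‖ ^ 2 / 2)|

theorem one_sub_exp_pos {x : ℝ} (hx : 0 < x) : 0 < 1 - Real.exp (-2 * x) := by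
  have : Real.exp (-2 * x) < 1 := by
    rw [← Real.exp_zero]
    exact Real.exp_lt_exp.2 (by linarith)
  linarith

theorem exp_two_mul_sub_one_pos {x : ℝ} (hx : 0 < x) : 0 < Real.exp (2 * x) - 1 := by
  have : 1 < Real.exp (2 * x) := Real.one_lt_exp_iff.2 (by linarith)
  linarith

theorem continuousOn_log_one_sub_exp :
    ContinuousOn (fun s : ℝ => Real.log (1 - Real.exp (-2 * s))) (Set.Ioi 0) := by
  refine ContinuousOn.log (by fun_prop) fun x hx => ?_
  exact (one_sub_exp_pos hx).ne'

theorem integrableOn_log_one_sub_exp {a : ℝ} (ha : 0 < a) :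
    IntegrableOn (fun s : ℝ => Real.log (1 - Real.exp (-2 * s))) (Set.Ioi a) := by
  have hg : IntegrableOn (fun s : ℝ => (1 - Real.exp (-2 * a))⁻¹ * Real.exp (-2 * s))
      (Set.Ioi a) :=
    (integrableOn_exp_mul_Ioi (by norm_num : (-2 : ℝ) < 0) a).const_mul _
  refine Integrable.mono' hg ?_ ?_
  · exact (continuousOn_log_one_sub_exp.mono (Set.Ioi_subset_Ioi ha.le)).aestronglyMeasurable
      measurableSet_Ioi
  · refine (ae_restrict_iff' measurableSet_Ioi).2 (Filter.Eventually.of_forall fun s hs => ?_)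
    have has : a < s := hs
    have h1 := one_sub_exp_pos ha
    have h2 := one_sub_exp_pos (ha.trans has)
    have h3 : Real.exp (-2 * s) ≤ Real.exp (-2 * a) := Real.exp_le_exp.2 (by linarith)
    have hu := Real.exp_pos (-2 * s)
    have hlog := Real.one_sub_inv_le_log_of_pos h2
    have hneg : Real.log (1 - Real.exp (-2 * s)) ≤ 0 := Real.log_nonpos h2.le (by linarith)
    rw [Real.norm_eq_abs, abs_of_nonpos hneg]
    calc -Real.log (1 - Real.exp (-2 * s))
        ≤ (1 - Real.exp (-2 * s))⁻¹ - 1 := by linarith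
      _ = (1 - Real.exp (-2 * s))⁻¹ * Real.exp (-2 * s) := by
          generalize Real.exp (-2 * s) = u at *
          have := h2.ne'
          field_simp
          ring
      _ ≤ (1 - Real.exp (-2 * a))⁻¹ * Real.exp (-2 * s) := by gcongr

theorem hasDerivAt_F {x : ℝ} (hx : 0 < x) :
    HasDerivAt F (1 / (2 * Real.pi ^ 2) * Real.log (1 - Real.exp (-2 * x))) x := by
  set f : ℝ → ℝ := fun s => Real.log (1 - Real.exp (-2 * s)) with hf
  have ha : 0 < x / 2 := by linarith
  have hcont : ContinuousOn f (Set.Ioi 0) := continuousOn_log_one_sub_exp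
  have hint : IntervalIntegrable f volume (x / 2) x :=
    (hcont.mono fun y hy => by
      rw [Set.uIcc_of_le (by linarith)] at hy
      exact ha.trans_le hy.1).intervalIntegrable
  have hd : HasDerivAt (fun u => ∫ s in (x / 2)..u, f s) (f x) x :=
    intervalIntegral.integral_hasDerivAt_right hint
      (hcont.stronglyMeasurableAtFilter isOpen_Ioi x hx)
      (hcont.continuousAt (Ioi_mem_nhds hx))
  have hd' := (hd.const_sub (∫ s in Set.Ioi (x / 2), f s)).const_mul (-(1 / (2 * Real.pi ^ 2)))
  refine (hd'.congr_of_eventuallyEq ?_).congr_deriv (by simp only [hf]; ring)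
  filter_upwards [Ioi_mem_nhds hx] with y hy
  have := intervalIntegral.integral_Ioi_sub_Ioi' (integrableOn_log_one_sub_exp ha)
    (integrableOn_log_one_sub_exp hy)
  simp only [F, hf]
  rw [← this]
  ring

theorem iteratedDeriv_succ_eq_of_hasDerivAt {f g g' : ℝ → ℝ} {s : Set ℝ} (hs : IsOpen s) {n : ℕ}
    (hf : ∀ x ∈ s, iteratedDeriv n f x = g x) (hg : ∀ x ∈ s, HasDerivAt g (g' x) x) :
    ∀ x ∈ s, iteratedDeriv (n + 1) f x = g' x := by
  intro x hx
  rw [iteratedDeriv_succ]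
  refine ((hg x hx).congr_of_eventuallyEq ?_).deriv
  filter_upwards [hs.mem_nhds hx] with y hy using hf y hy

theorem hasDerivAt_exp_two_mul (x : ℝ) :
    HasDerivAt (fun y : ℝ => Real.exp (2 * y)) (2 * Real.exp (2 * x)) x := by
  have := ((hasDerivAt_id x).const_mul 2).exp
  simpa [mul_comm] using this

theorem iteratedDeriv_two_F : ∀ x ∈ Set.Ioi (0 : ℝ), iteratedDeriv 2 F x =
    1 / (2 * Real.pi ^ 2) * (2 / (Real.exp (2 * x) - 1)) := by
  refine iteratedDeriv_succ_eq_of_hasDerivAt isOpen_Ioi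
    (g := fun x => 1 / (2 * Real.pi ^ 2) * Real.log (1 - Real.exp (-2 * x)))
    (fun x hx => ?_) fun x hx => ?_
  · rw [iteratedDeriv_one]
    exact (hasDerivAt_F hx).deriv
  · have h1 : HasDerivAt (fun y : ℝ => 1 - Real.exp (-2 * y)) (2 * Real.exp (-2 * x)) x := by
      have := (((hasDerivAt_id x).const_mul (-2)).exp).const_sub 1
      simpa [mul_comm] using this
    refine ((h1.log (one_sub_exp_pos hx).ne').const_mul _).congr_deriv ?_
    have h2 := (exp_two_mul_sub_one_pos hx).ne'
    have h3 := (one_sub_exp_pos hx).ne'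
    congr 1
    rw [div_eq_div_iff h3 h2]
    have : Real.exp (-2 * x) * Real.exp (2 * x) = 1 := by
      rw [← Real.exp_add]; simp
    linear_combination 2 * this

theorem iteratedDeriv_three_F : ∀ x ∈ Set.Ioi (0 : ℝ), iteratedDeriv 3 F x =
    1 / (2 * Real.pi ^ 2) * (-(4 * Real.exp (2 * x)) / (Real.exp (2 * x) - 1) ^ 2) := by
  refine iteratedDeriv_succ_eq_of_hasDerivAt isOpen_Ioi iteratedDeriv_two_F fun x hx => ?_
  have h2 := (exp_two_mul_sub_one_pos hx).ne'
  refine (((hasDerivAt_const x (2 : ℝ)).div ((hasDerivAt_exp_two_mul x).sub_const 1)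
    h2).const_mul _).congr_deriv ?_
  congr 2
  ring

theorem iteratedDeriv_four_F : ∀ x ∈ Set.Ioi (0 : ℝ), iteratedDeriv 4 F x =
    1 / (2 * Real.pi ^ 2) *
      (8 * Real.exp (2 * x) * (Real.exp (2 * x) + 1) / (Real.exp (2 * x) - 1) ^ 3) := by
  refine iteratedDeriv_succ_eq_of_hasDerivAt isOpen_Ioi iteratedDeriv_three_F fun x hx => ?_
  have h2 := (exp_two_mul_sub_one_pos hx).ne'
  refine ((((hasDerivAt_exp_two_mul x).const_mul 4).neg.div
    (((hasDerivAt_exp_two_mul x).sub_const 1).pow 2)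
    (pow_ne_zero 2 h2)).const_mul _).congr_deriv ?_
  congr 1
  simp only [Pi.neg_apply, Pi.pow_apply]
  field_simp
  push_cast
  ring

theorem V_le {m : ℕ} {v : EuclideanSpace ℂ (Fin m)} (hv : 0 < ‖v‖) :
    V m v ≤ 8 * Real.exp (‖v‖ ^ 2) * (Real.exp (‖v‖ ^ 2) + 1) / (Real.exp (‖v‖ ^ 2) - 1) ^ 3
        * ‖v‖ ^ 4
      + 4 * Real.exp (‖v‖ ^ 2) / (Real.exp (‖v‖ ^ 2) - 1) ^ 2 * ‖v‖ ^ 2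
      + 2 / (Real.exp (‖v‖ ^ 2) - 1) := by
  have hx : 0 < ‖v‖ ^ 2 / 2 := by positivity
  have hc0 : 0 ≤ 1 / (2 * Real.pi ^ 2) := by positivity
  have hc1 : 1 / (2 * Real.pi ^ 2) ≤ 1 := by
    rw [div_le_one (by positivity)]
    nlinarith [Real.pi_gt_three]
  have hE := exp_two_mul_sub_one_pos hx
  have h2 : 2 * (‖v‖ ^ 2 / 2) = ‖v‖ ^ 2 := by ring
  rw [V, iteratedDeriv_four_F _ hx, iteratedDeriv_three_F _ hx, iteratedDeriv_two_F _ hx]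
  rw [h2] at hE ⊢
  rw [neg_div, mul_neg, abs_neg]
  have hle : ∀ t : ℝ, 0 ≤ t → |1 / (2 * Real.pi ^ 2) * t| ≤ t := fun t ht => by
    rw [abs_of_nonneg (mul_nonneg hc0 ht)]
    exact mul_le_of_le_one_left ht hc1
  gcongr <;> exact hle _ (by positivity)

theorem V_le_of_norm_le_one {m : ℕ} {v : EuclideanSpace ℂ (Fin m)} (hv : 0 < ‖v‖)
    (hv1 : ‖v‖ ≤ 1) : V m v ≤ 110 / ‖v‖ ^ 2 := by
  refine (V_le hv).trans ?_
  have hx : 0 < ‖v‖ ^ 2 := by positivity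
  have h4 : ‖v‖ ^ 4 = (‖v‖ ^ 2) ^ 2 := by ring
  have hx1 : ‖v‖ ^ 2 ≤ 1 := pow_le_one₀ hv.le hv1
  rw [h4]
  generalize ‖v‖ ^ 2 = x at *
  have hE : x ≤ Real.exp x - 1 := by linarith [Real.add_one_le_exp x]
  have hE3 : Real.exp x ≤ 3 :=
    (Real.exp_le_exp.2 hx1).trans (by linarith [Real.exp_one_lt_d9])
  generalize Real.exp x = E at *
  have hE0 : 0 < E := by linarith
  calc _ ≤ 8 * 3 * (3 + 1) / x ^ 3 * x ^ 2 + 4 * 3 / x ^ 2 * x + 2 / x := by gcongr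
    _ = 110 / x := by field_simp; norm_num

theorem V_le_of_one_lt_norm {m : ℕ} {v : EuclideanSpace ℂ (Fin m)} (hv : 1 < ‖v‖) :
    V m v ≤ 148 * ‖v‖ ^ 4 * Real.exp (-‖v‖ ^ 2) := by
  refine (V_le (one_pos.trans hv)).trans ?_
  have h4 : ‖v‖ ^ 4 = (‖v‖ ^ 2) ^ 2 := by ring
  have hx1 : 1 < ‖v‖ ^ 2 := one_lt_pow₀ hv two_ne_zero
  rw [h4, Real.exp_neg]
  generalize ‖v‖ ^ 2 = x at *
  have hE : x + 1 ≤ Real.exp x := Real.add_one_le_exp x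
  generalize Real.exp x = E at *
  have hE0 : 0 < E := by linarith
  have hE1 : E / 2 ≤ E - 1 := by linarith
  have hE2 : E + 1 ≤ 2 * E := by linarith
  calc _ ≤ 8 * E * (2 * E) / (E / 2) ^ 3 * x ^ 2 + 4 * E / (E / 2) ^ 2 * x + 2 / (E / 2) := by
        gcongr
    _ = (128 * x ^ 2 + 16 * x + 4) * E⁻¹ := by field_simp; ring
    _ ≤ 148 * x ^ 2 * E⁻¹ := by
        gcongr
        nlinarith

/-- There is `C > 0` such that `V(v) ≤ C ‖v‖^{-2}` for `0 < ‖v‖ ≤ 1` and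
`V(v) ≤ C ‖v‖⁴ e^{-‖v‖²}` for `‖v‖ > 1`. -/
theorem V_bounds (m : ℕ) (hm : 1 ≤ m) :
    ∃ C : ℝ, 0 < C ∧
      (∀ v : EuclideanSpace ℂ (Fin m), 0 < ‖v‖ → ‖v‖ ≤ 1 →
        V m v ≤ C * ‖v‖ ^ (-2 : ℤ)) ∧
      (∀ v : EuclideanSpace ℂ (Fin m), 1 < ‖v‖ →
        V m v ≤ C * ‖v‖ ^ 4 * Real.exp (-‖v‖ ^ 2)) := by
  refine ⟨148, by norm_num, fun v hv hv1 => ?_, fun v hv => V_le_of_one_lt_norm hv⟩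
  have hz : ‖v‖ ^ (-2 : ℤ) = (‖v‖ ^ 2)⁻¹ := by
    rw [zpow_neg]
    norm_cast
  rw [hz, ← div_eq_mul_inv]
  exact (V_le_of_norm_le_one hv hv1).trans (by gcongr; norm_num)
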